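/- arXiv:2203.01763 — 2 statements merged into one kernel-verified Lean document; each statement's English description precedes it below -/
import Mathlib

section
/- Let (A, φ) be a *-probability space and let a ∈ A be a centred CCR-complex-Gaussian element with parameters ω₍1,*₎, ω₍*,1₎ ∈ (0,∞); set ω₍1,1₎ = ω₍*,*₎ := 0. Then for every k ∈ ℕ and every tuple (ε(1),…,ε(k)) ∈ {1,*}^k, φ(a^{ε(1)} ⋯ a^{ε(k)}) = ∑_{ρ ∈ P₂(k)} ∏_{pairs {p,q} of ρ with p<q} ω₍ε(p),ε(q)₎, with the right-hand side read as 0 for k odd (here a^1 := a and a^* is the adjoint of a). -/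
noncomputable section

/-- Pair partitions of `{1,…,k}`, encoded as fixed-point-free involutions of `Fin k`. -/
def pairInv (k : ℕ) : Finset (Equiv.Perm (Fin k)) :=
  Finset.univ.filter fun g => g * g = 1 ∧ ∀ x, g x ≠ x

section NormalOrdering

variable {A : Type*} [Ring A] [Algebra ℂ A]

/-- The triples `(x, ∂x/∂a, ∂x/∂b)` spanned by those of the normally ordered monomials
`x = a ^ p * b ^ q`. -/
inductive DerivTriple (a b : A) : A → A → A → Prop
  | monomial (p q : ℕ) :
      DerivTriple a b (a ^ p * b ^ q) ((p : ℂ) • (a ^ (p - 1) * b ^ q))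
        ((q : ℂ) • (a ^ p * b ^ (q - 1)))
  | add {x y z x' y' z' : A} : DerivTriple a b x y z → DerivTriple a b x' y' z' →
      DerivTriple a b (x + x') (y + y') (z + z')
  | smul {x y z : A} (r : ℂ) : DerivTriple a b x y z →
      DerivTriple a b (r • x) (r • y) (r • z)

theorem mul_pow_of_ccr {a b : A} {c : ℂ} (h : b * a = a * b + c • (1 : A)) (p : ℕ) :
    b * a ^ p = a ^ p * b + (c * p) • a ^ (p - 1) := by
  induction p with
  | zero => simp
  | succ p ih =>
    rw [pow_succ, ← mul_assoc, ih, add_mul, mul_assoc, h]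
    rcases p with _ | p
    · simp
    · simp only [Nat.add_sub_cancel, mul_add, ← mul_assoc, smul_mul_assoc, mul_smul_comm, mul_one,
        ← pow_succ, add_assoc, ← add_smul]
      congr 2
      push_cast
      ring

namespace DerivTriple

variable {a b x y z : A}

theorem mul_left_fst (h : DerivTriple a b x y z) :
    DerivTriple a b (a * x) (x + a * y) (a * z) := by
  induction h with
  | monomial p q =>
    convert monomial (p + 1) q using 1
    · rw [pow_succ', mul_assoc]
    · rcases p with _ | p
      · simp
      · simp only [Nat.add_sub_cancel, mul_smul_comm, ← mul_assoc, ← pow_succ']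
        push_cast
        module
    · rw [mul_smul_comm, ← mul_assoc, pow_succ']
  | add _ _ ih ih' =>
    convert ih.add ih' using 1 <;> noncomm_ring
  | smul r _ ih =>
    convert ih.smul r using 1 <;> simp only [mul_smul_comm, smul_add]

theorem mul_left_snd {c : ℂ} (hc : b * a = a * b + c • (1 : A)) (h : DerivTriple a b x y z) :
    DerivTriple a b (b * x) (b * y) (x + b * z) := by
  induction h with
  | monomial p q =>
    convert (monomial (a := a) (b := b) p (q + 1)).add
      ((monomial (a := a) (b := b) (p - 1) q).smul (c * p)) using 1
    · rw [← mul_assoc, mul_pow_of_ccr hc, add_mul, smul_mul_assoc, pow_succ', mul_assoc]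
    · rw [mul_smul_comm, ← mul_assoc, mul_pow_of_ccr hc, add_mul, smul_mul_assoc, pow_succ',
        mul_assoc]
      rcases p with _ | p
      · simp
      · simp only [Nat.add_sub_cancel]
        module
    · rw [mul_smul_comm, ← mul_assoc, mul_pow_of_ccr hc, add_mul, smul_mul_assoc, mul_assoc]
      rcases q with _ | q
      · simp
      · simp only [Nat.add_sub_cancel, ← pow_succ']
        push_cast
        module
  | add _ _ ih ih' =>
    convert ih.add ih' using 1 <;> noncomm_ring
  | smul r _ ih =>
    convert ih.smul r using 1 <;> simp only [mul_smul_comm, smul_add]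

theorem snd_mul {c : ℂ} (hc : b * a = a * b + c • (1 : A)) (h : DerivTriple a b x y z) :
    b * x = x * b + c • y := by
  induction h with
  | monomial p q =>
    rw [← mul_assoc, mul_pow_of_ccr hc, add_mul, smul_mul_assoc, mul_assoc, mul_assoc,
      ← pow_succ', ← pow_succ, smul_smul]
  | add _ _ ih ih' => rw [mul_add, ih, ih', add_mul, smul_add]; abel
  | smul r _ ih => rw [mul_smul_comm, ih, smul_mul_assoc, smul_add, smul_comm r c]

theorem map_fst_mul {φ : A →ₗ[ℂ] ℂ} {s : ℂ}
    (h0 : ∀ p q : ℕ, p ≠ q → φ (a ^ p * b ^ q) = 0)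
    (h1 : ∀ p : ℕ, φ (a ^ p * b ^ p) = (p.factorial : ℂ) * s ^ p)
    (h : DerivTriple a b x y z) : φ (a * x) = s * φ z := by
  induction h with
  | monomial p q =>
    rw [← mul_assoc, ← pow_succ', map_smul, smul_eq_mul]
    rcases q with _ | q
    · simpa using h0 (p + 1) 0 (by simp)
    · rw [Nat.add_sub_cancel]
      by_cases hpq : p = q
      · subst hpq
        rw [h1, h1, Nat.factorial_succ]
        push_cast
        ring
      · rw [h0 _ _ hpq, h0 _ _ (by omega)]
        simp
  | add _ _ ih ih' => rw [mul_add, map_add, ih, ih', map_add, mul_add]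
  | smul r _ ih =>
    rw [mul_smul_comm, map_smul, ih, map_smul, smul_eq_mul, smul_eq_mul]
    ring

theorem map_mul_snd {φ : A →ₗ[ℂ] ℂ} {s : ℂ}
    (h0 : ∀ p q : ℕ, p ≠ q → φ (a ^ p * b ^ q) = 0)
    (h1 : ∀ p : ℕ, φ (a ^ p * b ^ p) = (p.factorial : ℂ) * s ^ p)
    (h : DerivTriple a b x y z) : φ (x * b) = s * φ y := by
  induction h with
  | monomial p q =>
    rw [mul_assoc, ← pow_succ, map_smul, smul_eq_mul]
    rcases p with _ | p
    · simpa using h0 0 (q + 1) (by simp)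
    · rw [Nat.add_sub_cancel]
      by_cases hpq : p = q
      · subst hpq
        rw [h1, h1, Nat.factorial_succ]
        push_cast
        ring
      · rw [h0 _ _ hpq, h0 _ _ (by omega)]
        simp
  | add _ _ ih ih' => rw [add_mul, map_add, ih, ih', map_add, mul_add]
  | smul r _ ih =>
    rw [smul_mul_assoc, map_smul, ih, map_smul, smul_eq_mul, smul_eq_mul]
    ring

end DerivTriple

/-- The word in the letters `a` (for `false`) and `b` (for `true`) spelled by `δ`. -/
def wordProd {R : Type*} [Ring R] (a b : R) {n : ℕ} (δ : Fin n → Bool) : R :=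
  (List.ofFn fun h : Fin n => if δ h then b else a).prod

theorem wordProd_succ {R : Type*} [Ring R] (a b : R) {n : ℕ} (δ : Fin (n + 1) → Bool) :
    wordProd a b δ = (if δ 0 then b else a) * wordProd a b (fun j => δ j.succ) := by
  simp [wordProd, List.ofFn_succ]

theorem derivTriple_wordProd {a b : A} {c : ℂ} (hc : b * a = a * b + c • (1 : A)) {n : ℕ}
    (δ : Fin (n + 1) → Bool) :
    DerivTriple a b (wordProd a b δ)
      (∑ i, if δ i then 0 else wordProd a b fun j => δ (i.succAbove j))
      (∑ i, if δ i then wordProd a b fun j => δ (i.succAbove j) else 0) := by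
  induction n with
  | zero =>
    have h : DerivTriple a b 1 0 0 := by
      simpa using DerivTriple.monomial (a := a) (b := b) 0 0
    rw [Fin.sum_univ_one, Fin.sum_univ_one]
    rcases h0 : δ 0 with _ | _
    · simpa [wordProd, h0] using h.mul_left_fst
    · simpa [wordProd, h0] using h.mul_left_snd hc
  | succ n ih =>
    have ih := ih fun j => δ j.succ
    rw [wordProd_succ]
    simp only [Fin.sum_univ_succ (n := n + 1)]
    rcases h0 : δ 0 with _ | _
    · convert ih.mul_left_fst using 1
      · simp
      · simp [wordProd_succ a b (n := n), Finset.mul_sum, h0]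
      · simp [wordProd_succ a b (n := n), Finset.mul_sum, h0]
    · convert ih.mul_left_snd hc using 1
      · simp
      · simp [wordProd_succ a b (n := n), Finset.mul_sum, h0]
      · simp [wordProd_succ a b (n := n), Finset.mul_sum, h0]

end NormalOrdering

section PairPartitions

/-- The order embedding of `Fin k` into `Fin (k + 2)` that omits `0` and `i.succ`. -/
def skipPair {k : ℕ} (i : Fin (k + 1)) : Fin k ↪ Fin (k + 2) :=
  (Fin.succAboveEmb i).trans (Fin.succEmb (k + 1))

theorem skipPair_apply {k : ℕ} (i : Fin (k + 1)) (j : Fin k) :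
    skipPair i j = (i.succAbove j).succ := rfl

theorem exists_skipPair_eq {k : ℕ} (i : Fin (k + 1)) {x : Fin (k + 2)} (h0 : x ≠ 0)
    (hi : x ≠ i.succ) : ∃ j, skipPair i j = x := by
  obtain ⟨y, rfl⟩ := Fin.exists_succ_eq.2 h0
  obtain ⟨j, rfl⟩ := Fin.exists_succAbove_eq (x := y) (y := i) (fun h => hi (by rw [h]))
  exact ⟨j, rfl⟩

/-- Extend a permutation of `Fin k` along `skipPair i`, exchanging the two omitted points. -/
def insertPair {k : ℕ} (i : Fin (k + 1)) (g : Equiv.Perm (Fin k)) : Equiv.Perm (Fin (k + 2)) :=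
  g.viaEmbedding (skipPair i) * Equiv.swap 0 i.succ

theorem insertPair_zero {k : ℕ} (i : Fin (k + 1)) (g : Equiv.Perm (Fin k)) :
    insertPair i g 0 = i.succ := by
  rw [insertPair, Equiv.Perm.mul_apply, Equiv.swap_apply_left,
    Equiv.Perm.viaEmbedding_apply_of_notMem]
  rintro ⟨j, hj⟩
  exact Fin.succAbove_ne i j (Fin.succ_injective _ hj)

theorem insertPair_succ {k : ℕ} (i : Fin (k + 1)) (g : Equiv.Perm (Fin k)) :
    insertPair i g i.succ = 0 := by
  rw [insertPair, Equiv.Perm.mul_apply, Equiv.swap_apply_right,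
    Equiv.Perm.viaEmbedding_apply_of_notMem]
  rintro ⟨j, hj⟩
  exact Fin.succ_ne_zero _ hj

theorem insertPair_skipPair {k : ℕ} (i : Fin (k + 1)) (g : Equiv.Perm (Fin k)) (j : Fin k) :
    insertPair i g (skipPair i j) = skipPair i (g j) := by
  rw [insertPair, Equiv.Perm.mul_apply, Equiv.swap_apply_of_ne_of_ne,
    Equiv.Perm.viaEmbedding_apply]
  · exact Fin.succ_ne_zero _
  · exact fun h => Fin.succAbove_ne i j (Fin.succ_injective _ h)

theorem mem_pairInv {k : ℕ} {g : Equiv.Perm (Fin k)} :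
    g ∈ pairInv k ↔ (∀ x, g (g x) = x) ∧ ∀ x, g x ≠ x := by
  simp [pairInv, Equiv.ext_iff]

theorem forall_fin_skipPair {k : ℕ} (i : Fin (k + 1)) {P : Fin (k + 2) → Prop} (h0 : P 0)
    (hi : P i.succ) (h : ∀ j, P (skipPair i j)) (x : Fin (k + 2)) : P x := by
  by_cases hx0 : x = 0
  · rwa [hx0]
  by_cases hxi : x = i.succ
  · rwa [hxi]
  obtain ⟨j, rfl⟩ := exists_skipPair_eq i hx0 hxi
  exact h j

theorem insertPair_mem_pairInv {k : ℕ} (i : Fin (k + 1)) {g : Equiv.Perm (Fin k)}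
    (hg : g ∈ pairInv k) : insertPair i g ∈ pairInv (k + 2) := by
  rw [mem_pairInv] at hg ⊢
  refine ⟨forall_fin_skipPair i ?_ ?_ ?_, forall_fin_skipPair i ?_ ?_ ?_⟩
  · rw [insertPair_zero, insertPair_succ]
  · rw [insertPair_succ, insertPair_zero]
  · intro j
    rw [insertPair_skipPair, insertPair_skipPair, hg.1]
  · rw [insertPair_zero]
    exact Fin.succ_ne_zero _
  · rw [insertPair_succ]
    exact (Fin.succ_ne_zero _).symm
  · intro j
    rw [insertPair_skipPair]
    exact fun h => hg.2 j ((skipPair i).injective h)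

theorem insertPair_injective {k : ℕ} {i i' : Fin (k + 1)} {g g' : Equiv.Perm (Fin k)}
    (h : insertPair i g = insertPair i' g') : i = i' ∧ g = g' := by
  have hi : i = i' := by
    have := congrArg (fun f => f 0) h
    simp only [insertPair_zero] at this
    exact Fin.succ_injective _ this
  subst hi
  refine ⟨rfl, Equiv.ext fun j => (skipPair i).injective ?_⟩
  rw [← insertPair_skipPair, ← insertPair_skipPair, h]

theorem exists_insertPair_eq {k : ℕ} {f : Equiv.Perm (Fin (k + 2))} (hf : f ∈ pairInv (k + 2)) :
    ∃ i, ∃ g ∈ pairInv k, insertPair i g = f := by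
  rw [mem_pairInv] at hf
  obtain ⟨i, hi⟩ := Fin.exists_succ_eq.2 (hf.2 0)
  have hi' : f i.succ = 0 := by rw [hi, hf.1]
  have key : ∀ j, ∃ l, skipPair i l = f (skipPair i j) := by
    intro j
    apply exists_skipPair_eq
    · rw [← hi', f.injective.ne_iff]
      exact fun h => Fin.succAbove_ne i j (Fin.succ_injective _ h)
    · rw [hi, f.injective.ne_iff]
      exact Fin.succ_ne_zero _
  choose u hu using key
  have hinv : Function.Involutive u := fun j => (skipPair i).injective (by rw [hu, hu, hf.1])
  refine ⟨i, hinv.toPerm u, mem_pairInv.2 ⟨hinv, fun j h => hf.2 (skipPair i j) ?_⟩, ?_⟩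
  · rw [← hu]
    exact congrArg _ h
  · refine Equiv.ext (forall_fin_skipPair i ?_ ?_ fun j => ?_)
    · rw [insertPair_zero, hi]
    · rw [insertPair_succ, hi']
    · rw [insertPair_skipPair, ← hu]
      rfl

theorem sum_pairInv_add_two {M : Type*} [AddCommMonoid M] {k : ℕ}
    (F : Equiv.Perm (Fin (k + 2)) → M) :
    ∑ f ∈ pairInv (k + 2), F f = ∑ i, ∑ g ∈ pairInv k, F (insertPair i g) := by
  rw [← Finset.sum_product']
  symm
  refine Finset.sum_bij (fun x _ => insertPair x.1 x.2) ?_ ?_ ?_ ?_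
  · exact fun x hx => insertPair_mem_pairInv _ (Finset.mem_product.1 hx).2
  · intro x _ y _ h
    exact Prod.ext_iff.2 (insertPair_injective h)
  · intro f hf
    obtain ⟨i, g, hg, h⟩ := exists_insertPair_eq hf
    exact ⟨(i, g), by simpa using hg, h⟩
  · exact fun _ _ => rfl

theorem prod_insertPair {M : Type*} [CommMonoid M] {k : ℕ} (W : Fin (k + 2) → Fin (k + 2) → M)
    (i : Fin (k + 1)) (g : Equiv.Perm (Fin k)) :
    ∏ h ∈ Finset.univ.filter (fun h => h < insertPair i g h), W h (insertPair i g h) =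
      W 0 i.succ * ∏ h ∈ Finset.univ.filter (fun h => h < g h),
        W (skipPair i h) (skipPair i (g h)) := by
  have hlt (j l : Fin k) : skipPair i j < skipPair i l ↔ j < l := by
    simp [skipPair_apply]
  rw [Finset.prod_filter, Finset.prod_filter, Fin.prod_univ_succ, Fin.prod_univ_succAbove _ i]
  simp only [← skipPair_apply, insertPair_zero, insertPair_succ, insertPair_skipPair, hlt]
  simp

end PairPartitions

/-- Wick's lemma for a centred CCR-complex-Gaussian element of a
`*`-probability space `(A, φ)`.  A word `a^{ε(1)} ⋯ a^{ε(k)}` is encoded by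
`ε : Fin k → Bool`, where `ε h = false` stands for a factor `a` (the symbol `1`)
and `ε h = true` for a factor `a*` (the symbol `*`). -/
theorem stmt17 {A : Type*} [Ring A] [Algebra ℂ A] [StarRing A] [StarModule ℂ A]
    (φ : A →ₗ[ℂ] ℂ) (hφ1 : φ 1 = 1)
    (a : A) (ω1 ωs : ℝ) (hω1 : 0 < ω1) (hωs : 0 < ωs)
    (hccr : star a * a = a * star a + algebraMap ℂ A ((ωs : ℂ) - (ω1 : ℂ)))
    (hmom0 : ∀ p q : ℕ, p ≠ q → φ (a ^ p * (star a) ^ q) = 0)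
    (hmom1 : ∀ p : ℕ, φ (a ^ p * (star a) ^ p) = (p.factorial : ℂ) * (ω1 : ℂ) ^ p)
    (k : ℕ) (ε : Fin k → Bool) :
    φ ((List.ofFn fun h : Fin k => if ε h then star a else a).prod) =
      ∑ g ∈ pairInv k,
        ((∏ h ∈ Finset.univ.filter (fun h : Fin k => h < g h),
          (if ε h = false ∧ ε (g h) = true then ω1
            else if ε h = true ∧ ε (g h) = false then ωs else 0) : ℝ) : ℂ) := by
  let b := star a
  have hc : b * a = a * b + ((ωs : ℂ) - ω1) • (1 : A) := by
    rw [hccr, Algebra.algebraMap_eq_smul_one]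
  change φ (wordProd a b ε) = _
  induction k using Nat.twoStepInduction with
  | zero =>
    have h : pairInv 0 = {1} := by
      ext g
      simp [mem_pairInv, Subsingleton.elim g 1]
    simp [wordProd, hφ1, h]
  | one =>
    have h : pairInv 1 = ∅ := by
      ext g
      simp [mem_pairInv, Subsingleton.elim (g 0) 0]
    have ha : φ a = 0 := by simpa using hmom0 1 0 (by simp)
    have hb : φ b = 0 := by simpa using hmom0 0 1 (by simp)
    rcases h0 : ε 0 with _ | _ <;> simp [wordProd, h, h0, ha, hb]
  | more k ih _ =>
    have hd := derivTriple_wordProd hc fun j => ε j.succ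
    rw [sum_pairInv_add_two, wordProd_succ]
    simp only [prod_insertPair fun x y => (if ε x = false ∧ ε y = true then ω1
      else if ε x = true ∧ ε y = false then ωs else 0 : ℝ), Complex.ofReal_mul, ← Finset.mul_sum]
    simp only [← fun i => ih fun j => ε (skipPair i j)]
    simp only [skipPair_apply]
    rcases h0 : ε 0 with _ | _
    · simp only [Bool.false_eq_true, if_false]
      rw [hd.map_fst_mul hmom0 hmom1, map_sum, Finset.mul_sum]
      refine Finset.sum_congr rfl fun i _ => ?_
      rcases hi : ε i.succ with _ | _ <;> simp
    · simp only [if_true]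
      rw [hd.snd_mul hc, map_add, hd.map_mul_snd hmom0 hmom1, map_smul, smul_eq_mul, ← add_mul,
        add_sub_cancel, map_sum, Finset.mul_sum]
      refine Finset.sum_congr rfl fun i _ => ?_
      rcases hi : ε i.succ with _ | _ <;> simp
end
end

section
/- Let (A, φ) be a *-probability space and let M = [a_{i,j}]_{i,j=1}^d ∈ M_d(A) be a traceless CCR-GUE matrix with parameters w_1,…,w_d. Then for every k ∈ ℕ and all tuples i, j : {1,…,k} → {1,…,d}, φ(a_{i(1),j(1)} ⋯ a_{i(k),j(k)}) = ∑_{ρ ∈ P₂^{(b-r)}(k)} ( ∏_{blue pairs {p,q} of ρ, p<q} δ_{i(p),j(q)} δ_{i(q),j(p)} w_{i(q)} · ∏_{red pairs {p,q} of ρ, p<q} δ_{i(p),j(p)} δ_{i(q),j(q)} (− w_{i(p)} w_{i(q)}) ), where δ is the Kronecker delta. -/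
noncomputable section

/-- A family `S` of unital `*`-subalgebras of a `*`-probability space `(A, φ)` is
commuting independent if elements of distinct members commute, and `φ` is multiplicative
across products of elements taken from pairwise distinct members of the family. -/
def CommIndep {A : Type*} [Ring A] [Algebra ℂ A] [StarRing A] [StarModule ℂ A]
    {Λ : Type*} (φ : A →ₗ[ℂ] ℂ) (S : Λ → StarSubalgebra ℂ A) : Prop :=
  (∀ l₁ l₂ : Λ, l₁ ≠ l₂ → ∀ x ∈ S l₁, ∀ y ∈ S l₂, x * y = y * x) ∧
  ∀ (m : ℕ) (l : Fin m → Λ), Function.Injective l →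
    ∀ x : Fin m → A, (∀ h, x h ∈ S (l h)) →
      φ (List.ofFn x).prod = ∏ h, φ (x h)

/-- `a` is a centred CCR-complex-Gaussian element of `(A, φ)` with parameters
`ω1 = ω_{(1,*)}` and `ωs = ω_{(*,1)}` in `(0,∞)`. -/
def IsCCRGaussian {A : Type*} [Ring A] [Algebra ℂ A] [StarRing A]
    (φ : A →ₗ[ℂ] ℂ) (a : A) (ω1 ωs : ℝ) : Prop :=
  0 < ω1 ∧ 0 < ωs ∧
  star a * a = a * star a + algebraMap ℂ A ((ωs : ℂ) - (ω1 : ℂ)) ∧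
  (∀ p q : ℕ, p ≠ q → φ (a ^ p * (star a) ^ q) = 0) ∧
  ∀ p : ℕ, φ (a ^ p * (star a) ^ p) = (p.factorial : ℂ) * (ω1 : ℂ) ^ p

/-- The selfadjoint elements `x 0, …, x (d-1)` form a centred Gaussian family with
covariance matrix `C`: their joint moments are given by the Wick formula. -/
def IsGaussianFamily {A : Type*} [Ring A] [Algebra ℂ A]
    {d : ℕ} (φ : A →ₗ[ℂ] ℂ) (x : Fin d → A) (C : Fin d → Fin d → ℝ) : Prop :=
  ∀ (k : ℕ) (m : Fin k → Fin d),
    φ (List.ofFn fun h : Fin k => x (m h)).prod =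
      ∑ g ∈ pairInv k,
        ((∏ h ∈ Finset.univ.filter (fun h : Fin k => h < g h), C (m h) (m (g h)) : ℝ) : ℂ)

section Wick

variable {I : Type*}

/-- The derivation of the polynomial algebra sending the variable `X y` to `K x y`. -/
def contraction (K : I → I → ℂ) (x : I) :
    Derivation ℂ (MvPolynomial I ℂ) (MvPolynomial I ℂ) :=
  MvPolynomial.mkDerivation ℂ fun y => MvPolynomial.C (K x y)

/-- The word `l` of field operators `X x + contraction K x` applied to `q`. -/
def fieldWord (K : I → I → ℂ) (l : List I) (q : MvPolynomial I ℂ) : MvPolynomial I ℂ :=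
  l.foldr (fun x p => MvPolynomial.X x * p + contraction K x p) q

/-- The vacuum expectation of a word of field operators. -/
def wick (K : I → I → ℂ) (l : List I) : ℂ :=
  MvPolynomial.constantCoeff (fieldWord K l 1)

variable (K : I → I → ℂ)

@[simp] lemma contraction_X (x y : I) :
    contraction K x (MvPolynomial.X y) = MvPolynomial.C (K x y) := by
  simp [contraction]

@[simp] lemma contraction_C (x : I) (c : ℂ) :
    contraction K x (MvPolynomial.C c) = 0 := by
  simp [contraction]

lemma contraction_comm (x y : I) (p : MvPolynomial I ℂ) :
    contraction K x (contraction K y p) = contraction K y (contraction K x p) := by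
  have h : ⁅contraction K x, contraction K y⁆ = 0 := by
    apply MvPolynomial.derivation_ext
    intro z
    simp [Derivation.commutator_apply]
  have h2 := congrArg (fun D => D p) h
  simpa [Derivation.commutator_apply, sub_eq_zero] using h2

@[simp] lemma fieldWord_nil (q : MvPolynomial I ℂ) : fieldWord K [] q = q := rfl

lemma fieldWord_cons (x : I) (l : List I) (q : MvPolynomial I ℂ) :
    fieldWord K (x :: l) q =
      MvPolynomial.X x * fieldWord K l q + contraction K x (fieldWord K l q) := rfl

lemma fieldWord_append (l₁ l₂ : List I) (q : MvPolynomial I ℂ) :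
    fieldWord K (l₁ ++ l₂) q = fieldWord K l₁ (fieldWord K l₂ q) := by
  simp [fieldWord]

lemma fieldWord_add (l : List I) (p q : MvPolynomial I ℂ) :
    fieldWord K l (p + q) = fieldWord K l p + fieldWord K l q := by
  induction l with
  | nil => rfl
  | cons x l ih => simp only [fieldWord_cons, ih, map_add]; ring

lemma fieldWord_mul {l : List I} {q : MvPolynomial I ℂ}
    (h : ∀ x ∈ l, contraction K x q = 0) (p : MvPolynomial I ℂ) :
    fieldWord K l (q * p) = q * fieldWord K l p := by
  induction l with
  | nil => rfl
  | cons x l ih =>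
    rw [fieldWord_cons, fieldWord_cons, ih fun y hy => h y (List.mem_cons_of_mem _ hy),
      Derivation.leibniz, h x List.mem_cons_self]
    simp only [smul_eq_mul]
    ring

lemma fieldWord_C_mul (l : List I) (c : ℂ) (p : MvPolynomial I ℂ) :
    fieldWord K l (MvPolynomial.C c * p) = MvPolynomial.C c * fieldWord K l p :=
  fieldWord_mul K (fun x _ => contraction_C K x c) p

lemma fieldWord_swap (x y : I) (l : List I) (q : MvPolynomial I ℂ) :
    fieldWord K (x :: y :: l) q = fieldWord K (y :: x :: l) q +
      MvPolynomial.C (K x y - K y x) * fieldWord K l q := by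
  simp only [fieldWord_cons, map_add, Derivation.leibniz, contraction_X, smul_eq_mul, map_sub,
    contraction_comm K x y]
  ring

/-- A contraction passes through a field operator up to a scalar. -/
lemma contraction_fieldWord_cons (x y : I) (l : List I) (q : MvPolynomial I ℂ) :
    contraction K x (fieldWord K (y :: l) q) = MvPolynomial.C (K x y) * fieldWord K l q +
      fieldWord K [y] (contraction K x (fieldWord K l q)) := by
  simp only [fieldWord_cons, fieldWord_nil, map_add, Derivation.leibniz, contraction_X,
    smul_eq_mul, contraction_comm K x y]
  ring

lemma contraction_fieldWord_of_zero {x : I} {l : List I} (h : ∀ y ∈ l, K x y = 0)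
    (q : MvPolynomial I ℂ) :
    contraction K x (fieldWord K l q) = fieldWord K l (contraction K x q) := by
  induction l with
  | nil => rfl
  | cons y l ih =>
    rw [contraction_fieldWord_cons, h y List.mem_cons_self,
      ih fun z hz => h z (List.mem_cons_of_mem _ hz), ← fieldWord_append]
    simp

lemma fieldWord_zero (l : List I) : fieldWord K l 0 = 0 := by
  induction l with
  | nil => rfl
  | cons x l ih => simp [fieldWord_cons, ih]

@[simp] lemma wick_nil : wick K [] = 1 := by simp [wick]

lemma wick_swap (l₁ l₂ : List I) (x y : I) :
    wick K (l₁ ++ x :: y :: l₂) = wick K (l₁ ++ y :: x :: l₂) +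
      (K x y - K y x) * wick K (l₁ ++ l₂) := by
  simp only [wick, fieldWord_append, fieldWord_swap K x y, fieldWord_add, fieldWord_C_mul, map_add,
    map_mul, MvPolynomial.constantCoeff_C]

lemma constantCoeff_fieldWord_cons (x : I) (l : List I) (q : MvPolynomial I ℂ) :
    MvPolynomial.constantCoeff (fieldWord K (x :: l) q) =
      MvPolynomial.constantCoeff (contraction K x (fieldWord K l q)) := by
  simp [fieldWord_cons]

lemma wick_append {l₁ l₂ : List I} (h : ∀ x ∈ l₁, ∀ y ∈ l₂, K x y = 0) :
    wick K (l₁ ++ l₂) = wick K l₁ * wick K l₂ := by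
  have h2 : ∀ x ∈ l₁, contraction K x (fieldWord K l₂ 1) = 0 := by
    intro x hx
    rw [contraction_fieldWord_of_zero K (h x hx), ← MvPolynomial.C_1, contraction_C,
      fieldWord_zero]
  rw [wick, fieldWord_append, ← mul_one (fieldWord K l₂ 1), fieldWord_mul K h2, map_mul,
    mul_comm]
  rfl

lemma wick_flatMap {L : Type*} {t : List L} (ht : t.Nodup) (f : L → List I)
    (h : ∀ r s, r ≠ s → ∀ x ∈ f r, ∀ y ∈ f s, K x y = 0) :
    wick K (t.flatMap f) = (t.map fun r => wick K (f r)).prod := by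
  induction t with
  | nil => simp
  | cons r t ih =>
    rw [List.nodup_cons] at ht
    rw [List.flatMap_cons, wick_append K, ih ht.2, List.map_cons, List.prod_cons]
    intro x hx y hy
    obtain ⟨s, hs, hy⟩ := List.mem_flatMap.1 hy
    exact h r s (fun e => ht.1 (e ▸ hs)) x hx y hy

lemma fieldWord_replicate {y : I} (hy : K y y = 0) (q : ℕ) :
    fieldWord K (List.replicate q y) 1 = MvPolynomial.X y ^ q := by
  induction q with
  | zero => simp
  | succ q ih =>
    rw [List.replicate_succ, fieldWord_cons, ih, Derivation.leibniz_pow, contraction_X, hy]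
    simp [pow_succ']

lemma constantCoeff_fieldWord_replicate {x y : I} (hx : K x x = 0) (p q : ℕ) :
    MvPolynomial.constantCoeff (fieldWord K (List.replicate p x) (MvPolynomial.X y ^ q)) =
      if p = q then (p.factorial : ℂ) * K x y ^ p else 0 := by
  induction p generalizing q with
  | zero => cases q <;> simp
  | succ p ih =>
    rw [List.replicate_succ, constantCoeff_fieldWord_cons,
      contraction_fieldWord_of_zero K (by intro z hz; rw [List.eq_of_mem_replicate hz, hx])]
    cases q with
    | zero => simp [fieldWord_zero]
    | succ q =>
      have e : contraction K x (MvPolynomial.X y ^ (q + 1)) =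
          MvPolynomial.C (((q + 1 : ℕ) : ℂ) * K x y) * MvPolynomial.X y ^ q := by
        rw [Derivation.leibniz_pow, contraction_X]
        simp
        ring
      rw [e, fieldWord_C_mul, map_mul, ih, MvPolynomial.constantCoeff_C]
      by_cases hpq : p = q
      · subst hpq
        simp [Nat.factorial_succ, pow_succ]
        ring
      · simp [hpq]

lemma wick_replicate_append {x y : I} (hx : K x x = 0) (hy : K y y = 0) (p q : ℕ) :
    wick K (List.replicate p x ++ List.replicate q y) =
      if p = q then (p.factorial : ℂ) * K x y ^ p else 0 := by
  rw [wick, fieldWord_append, fieldWord_replicate K hy, constantCoeff_fieldWord_replicate K hx]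

lemma contraction_fieldWord_map {α : Type*} [DecidableEq α] (u : α → I) (x : I) {l : List α}
    (hl : l.Nodup) :
    contraction K x (fieldWord K (l.map u) 1) =
      ∑ t ∈ l.toFinset, MvPolynomial.C (K x (u t)) * fieldWord K ((l.erase t).map u) 1 := by
  induction l with
  | nil => simp
  | cons y l ih =>
    rw [List.nodup_cons] at hl
    rw [List.map_cons, contraction_fieldWord_cons, ih hl.2, List.toFinset_cons,
      Finset.sum_insert (by simpa using hl.1), List.erase_cons_head]
    congr 1
    have hs : ∀ s : Finset α, ∀ F : α → MvPolynomial I ℂ,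
        fieldWord K [u y] (∑ t ∈ s, F t) = ∑ t ∈ s, fieldWord K [u y] (F t) := by
      intro s F
      simp [fieldWord_cons, Finset.mul_sum, Finset.sum_add_distrib]
    rw [hs]
    refine Finset.sum_congr rfl fun t ht => ?_
    have hty : y ≠ t := by
      rintro rfl
      exact hl.1 (by simpa using ht)
    rw [fieldWord_C_mul, List.erase_cons_tail (by simpa using hty), List.map_cons,
      ← fieldWord_append]
    rfl

lemma wick_map_cons {α : Type*} [DecidableEq α] (u : α → I) (m : α) {l : List α}
    (hl : l.Nodup) :
    wick K ((m :: l).map u) =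
      ∑ t ∈ l.toFinset, K (u m) (u t) * wick K ((l.erase t).map u) := by
  rw [List.map_cons, wick, constantCoeff_fieldWord_cons, contraction_fieldWord_map K u _ hl]
  simp [wick]

end Wick

section Involutions

variable {α : Type*} [Fintype α] [LinearOrder α]

/-- The involutions of `α` moving exactly the elements of `l`. -/
def involutionsMoving (l : List α) : Finset (Equiv.Perm α) :=
  Finset.univ.filter fun g => g * g = 1 ∧ ∀ x, g x ≠ x ↔ x ∈ l

lemma mem_involutionsMoving {l : List α} {g : Equiv.Perm α} :
    g ∈ involutionsMoving l ↔ (∀ x, g (g x) = x) ∧ ∀ x, g x ≠ x ↔ x ∈ l := by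
  simp [involutionsMoving, Equiv.Perm.ext_iff]

lemma swap_mul_mem_erase {m : α} {l : List α} (hl : (m :: l).Nodup) {g : Equiv.Perm α}
    (hg : g ∈ involutionsMoving (m :: l)) :
    Equiv.swap m (g m) * g ∈ involutionsMoving (l.erase (g m)) := by
  rw [mem_involutionsMoving] at hg ⊢
  obtain ⟨h1, h2⟩ := hg
  rw [List.nodup_cons] at hl
  have hm : g m ≠ m := (h2 m).2 List.mem_cons_self
  have key : ∀ x, (Equiv.swap m (g m) * g) x = if x = m ∨ x = g m then x else g x := by
    intro x
    rw [Equiv.Perm.mul_apply]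
    by_cases hx : x = m
    · subst hx; simp
    · by_cases hx' : x = g m
      · subst hx'; simp [h1]
      · rw [Equiv.swap_apply_of_ne_of_ne]
        · simp [hx, hx']
        · intro e; exact hx' (by rw [← e, h1])
        · intro e; exact hx (g.injective e)
  constructor
  · intro x
    rw [key x]
    split_ifs with hx
    · rw [key x, if_pos hx]
    · rw [key, if_neg, h1]
      rintro (e | e)
      · exact hx (Or.inr (by rw [← e, h1]))
      · exact hx (Or.inl (g.injective e))
  · intro x
    rw [key x, hl.2.mem_erase_iff]
    have := h2 x
    rw [List.mem_cons] at this
    split_ifs with hx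
    · rcases hx with rfl | rfl
      · simp [hl.1]
      · simp
    · push Not at hx
      rw [this]
      simp [hx.1, hx.2]

lemma swap_mul_mem_cons {m t : α} {l : List α} (hl : (m :: l).Nodup) (ht : t ∈ l)
    {g : Equiv.Perm α} (hg : g ∈ involutionsMoving (l.erase t)) :
    Equiv.swap m t * g ∈ involutionsMoving (m :: l) ∧ (Equiv.swap m t * g) m = t ∧
      ∀ x, (Equiv.swap m t * g) x = if x = m then t else if x = t then m else g x := by
  rw [mem_involutionsMoving] at hg ⊢
  obtain ⟨h1, h2⟩ := hg
  rw [List.nodup_cons] at hl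
  have hmt : t ≠ m := by rintro rfl; exact hl.1 ht
  have gm : g m = m := by
    by_contra h
    exact hl.1 (List.mem_of_mem_erase ((h2 m).1 h))
  have gt : g t = t := by
    by_contra h
    exact ((hl.2.mem_erase_iff).1 ((h2 t).1 h)).1 rfl
  have key : ∀ x, (Equiv.swap m t * g) x = if x = m then t else if x = t then m else g x := by
    intro x
    rw [Equiv.Perm.mul_apply]
    by_cases hx : x = m
    · subst hx; simp [gm]
    · by_cases hx' : x = t
      · subst hx'; simp [gt, hx]
      · rw [Equiv.swap_apply_of_ne_of_ne]
        · simp [hx, hx']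
        · intro e; exact hx (g.injective (by rw [e, gm]))
        · intro e; exact hx' (g.injective (by rw [e, gt]))
  refine ⟨⟨?_, ?_⟩, by simp [key], key⟩
  · intro x
    rw [key x]
    split_ifs with hx hx'
    · rw [key, if_neg hmt, if_pos rfl, hx]
    · rw [key, if_pos rfl, hx']
    · rw [key, if_neg, if_neg, h1]
      · intro e; exact hx' (g.injective (by rw [e, gt]))
      · intro e; exact hx (g.injective (by rw [e, gm]))
  · intro x
    have h2x := h2 x
    rw [hl.2.mem_erase_iff] at h2x
    rw [key x, List.mem_cons]
    split_ifs with hx hx'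
    · subst hx; simpa using hmt
    · subst hx'; simp [ht, hmt.symm]
    · rw [h2x]; simp [hx, hx']

/-- The Wick sum over involutions moving a sorted list is the vacuum expectation. -/
lemma sum_involutionsMoving {I : Type*} (K : I → I → ℂ) (u : α → I) (l : List α)
    (hl : l.Pairwise (· < ·)) :
    ∑ g ∈ involutionsMoving l, ∏ h ∈ Finset.univ.filter (fun h => h < g h), K (u h) (u (g h)) =
      wick K (l.map u) := by
  induction hn : l.length using Nat.strong_induction_on generalizing l with
  | _ n ih =>
  cases l with
  | nil =>
    have : involutionsMoving ([] : List α) = {1} := by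
      ext g
      simp only [mem_involutionsMoving, List.not_mem_nil, iff_false, not_not,
        Finset.mem_singleton, Equiv.Perm.ext_iff, Equiv.Perm.one_apply]
      exact ⟨fun h => h.2, fun h => ⟨fun x => by rw [h, h], h⟩⟩
    simp [this]
  | cons m l =>
    have hnd : (m :: l).Nodup := hl.imp ne_of_lt
    have hnd' := (List.nodup_cons.1 hnd)
    rw [List.pairwise_cons] at hl
    rw [wick_map_cons K u m hnd'.2]
    rw [← Finset.sum_fiberwise_of_maps_to (t := l.toFinset) (g := fun g => g m)]
    · refine Finset.sum_congr rfl fun t ht => ?_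
      rw [List.mem_toFinset] at ht
      rw [← ih (l.erase t).length (by
        rw [List.length_erase_of_mem ht, ← hn, List.length_cons]; omega) (l.erase t)
        (hl.2.sublist List.erase_sublist) rfl, Finset.mul_sum]
      refine Finset.sum_bij' (fun g _ => Equiv.swap m t * g) (fun g _ => Equiv.swap m t * g)
        ?_ ?_ ?_ ?_ ?_
      · intro g hg
        rw [Finset.mem_filter] at hg
        obtain ⟨hg, rfl⟩ := hg
        exact swap_mul_mem_erase hnd hg
      · intro g hg
        obtain ⟨h1, h2, -⟩ := swap_mul_mem_cons hnd ht hg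
        exact Finset.mem_filter.2 ⟨h1, h2⟩
      · intro g _
        simp [← mul_assoc]
      · intro g _
        simp [← mul_assoc]
      · intro g hg
        rw [Finset.mem_filter] at hg
        obtain ⟨hg, rfl⟩ := hg
        have hg' := swap_mul_mem_erase hnd hg
        obtain ⟨-, -, hk⟩ := swap_mul_mem_cons hnd ht hg'
        rw [← mul_assoc, Equiv.swap_mul_self, one_mul] at hk
        generalize Equiv.swap m (g m) * g = g' at hg' hk ⊢
        generalize g m = t at ht hg' hk
        rw [mem_involutionsMoving] at hg'
        have hmt : m < t := hl.1 t ht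
        have gm : g' m = m := by
          by_contra h
          exact hnd'.1 (List.mem_of_mem_erase ((hg'.2 m).1 h))
        have gt : g' t = t := by
          by_contra h
          exact ((hnd'.2.mem_erase_iff).1 ((hg'.2 t).1 h)).1 rfl
        have hset : Finset.univ.filter (fun h => h < g h) =
            insert m (Finset.univ.filter fun h => h < g' h) := by
          ext h
          simp only [Finset.mem_filter, Finset.mem_univ, true_and, Finset.mem_insert, hk]
          by_cases h1 : h = m
          · simp [h1, hmt]
          · by_cases h2 : h = t
            · simp [h2, hmt.ne', gt, hmt.le]
            · simp [h1, h2]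
        rw [hset, Finset.prod_insert (by simp [gm]), hk m, if_pos rfl]
        congr 1
        refine Finset.prod_congr rfl fun h hh => ?_
        rw [Finset.mem_filter] at hh
        rw [hk h, if_neg, if_neg]
        · rintro rfl; exact absurd hh.2 (by simp [gt])
        · rintro rfl; exact absurd hh.2 (by simp [gm])
    · intro g hg
      rw [mem_involutionsMoving] at hg
      have hm : g m ≠ m := (hg.2 m).2 List.mem_cons_self
      have : g m ∈ m :: l := (hg.2 _).1 (by rw [hg.1]; exact hm.symm)
      simpa [hm] using this

lemma sum_pairInv {I : Type*} (K : I → I → ℂ) {k : ℕ} (u : Fin k → I) :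
    ∑ g ∈ pairInv k, ∏ h ∈ Finset.univ.filter (fun h => h < g h), K (u h) (u (g h)) =
      wick K (List.ofFn u) := by
  have h := sum_involutionsMoving K u (List.finRange k) (List.pairwise_lt_finRange k)
  rw [← List.ofFn_eq_map] at h
  rw [← h]
  congr 1
  ext g
  simp [pairInv, involutionsMoving]

/-- Summing over colourings constant on the pairs of an involution expands a product of sums. -/
lemma sum_colourings {k : ℕ} {g : Equiv.Perm (Fin k)} (hg : ∀ x, g (g x) = x)
    (hf : ∀ x, g x ≠ x) (B R : Fin k → ℝ) :
    ∑ c ∈ Finset.univ.filter (fun c : Fin k → Bool => ∀ x, c (g x) = c x),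
        (∏ h ∈ Finset.univ.filter (fun h => h < g h ∧ c h = true), B h) *
          ∏ h ∈ Finset.univ.filter (fun h => h < g h ∧ c h = false), R h =
      ∏ h ∈ Finset.univ.filter (fun h => h < g h), (B h + R h) := by
  rw [Finset.prod_add]
  refine Finset.sum_bij' (fun c _ => Finset.univ.filter fun h => h < g h ∧ c h = true)
    (fun t _ h => decide (if h < g h then h ∈ t else g h ∈ t)) ?_ ?_ ?_ ?_ ?_
  · intro c _
    rw [Finset.mem_powerset]
    intro h hh
    simp only [Finset.mem_filter] at hh ⊢
    exact ⟨hh.1, hh.2.1⟩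
  · intro t _
    simp only [Finset.mem_filter, Finset.mem_univ, true_and, hg]
    intro x
    rcases lt_or_gt_of_ne (hf x) with h | h
    · simp [h, h.not_gt]
    · simp [h, h.not_gt]
  · intro c hc
    simp only [Finset.mem_filter, Finset.mem_univ, true_and] at hc
    funext h
    rcases lt_or_gt_of_ne (hf h) with h' | h'
    · simp [h', h'.not_gt, hg, hc]
    · simp [h']
  · intro t ht
    rw [Finset.mem_powerset] at ht
    ext h
    simp only [Finset.mem_filter, Finset.mem_univ, true_and, decide_eq_true_eq]
    constructor
    · rintro ⟨h1, h2⟩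
      simpa [h1] using h2
    · intro hh
      have := (Finset.mem_filter.1 (ht hh)).2
      exact ⟨this, by simpa [this] using hh⟩
  · intro c _
    congr 1
    refine Finset.prod_congr ?_ fun _ _ => rfl
    ext h
    simp only [Finset.mem_filter, Finset.mem_univ, true_and, Finset.mem_sdiff]
    cases c h <;> simp

end Involutions

section Reordering

variable {I A : Type*} [Ring A] [Algebra ℂ A]

/-- If the letters satisfy the canonical commutation relations with commutators given by `K`,
the Wick formula may be checked after reordering, provided it holds for shorter words. -/
lemma wick_formula_of_perm (K : I → I → ℂ) (φ : A →ₗ[ℂ] ℂ) (a : I → A)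
    (l₀ : List I)
    (hcomm : ∀ x ∈ l₀, ∀ y ∈ l₀, a x * a y = a y * a x + algebraMap ℂ A (K x y - K y x))
    (hshort : ∀ l : List I, l.length < l₀.length → (∀ x ∈ l, x ∈ l₀) →
      φ (l.map a).prod = wick K l)
    {l₁ : List I} (hp : l₀.Perm l₁) (h₁ : φ (l₁.map a).prod = wick K l₁) :
    φ (l₀.map a).prod = wick K l₀ := by
  have key : ∀ {s t : List I}, s.Perm t → ∀ pre : List I,
      (pre ++ s).length = l₀.length → (∀ x ∈ pre ++ s, x ∈ l₀) →
      φ ((pre ++ s).map a).prod - wick K (pre ++ s) =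
        φ ((pre ++ t).map a).prod - wick K (pre ++ t) := by
    intro s t hst
    induction hst with
    | nil => intros; rfl
    | cons x _ ih =>
      intro pre hlen hmem
      have := ih (pre ++ [x]) (by simpa using hlen) (by simpa using hmem)
      simpa using this
    | swap x y r =>
      intro pre hlen hmem
      rw [wick_swap, ← hshort (pre ++ r)]
      · simp only [List.map_append, List.map_cons, List.prod_append, List.prod_cons]
        rw [← mul_assoc (a y), hcomm y (hmem _ (by simp)) x (hmem _ (by simp)),
          add_mul, mul_add, map_add, ← Algebra.smul_def, mul_smul_comm, map_smul, smul_eq_mul,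
          mul_assoc (a x)]
        ring
      · rw [← hlen]; simp
      · intro z hz
        apply hmem
        simp only [List.mem_append, List.mem_cons] at hz ⊢
        tauto
    | trans p q ih₁ ih₂ =>
      intro pre hlen hmem
      rw [ih₁ pre hlen hmem]
      refine ih₂ pre ?_ ?_
      · rw [← hlen]; simp [p.length_eq]
      · intro z hz
        apply hmem
        rw [List.mem_append] at hz ⊢
        rwa [p.mem_iff]
  have := key hp [] rfl (fun x hx => hx)
  simp only [List.nil_append, h₁, sub_self] at this
  exact sub_eq_zero.1 this

lemma exists_perm_replicate {x y : I} (l : List I) (h : ∀ z ∈ l, z = x ∨ z = y) :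
    ∃ p q : ℕ, l.Perm (List.replicate p x ++ List.replicate q y) := by
  induction l with
  | nil => exact ⟨0, 0, by simp⟩
  | cons z l ih =>
    obtain ⟨p, q, hpq⟩ := ih fun t ht => h t (List.mem_cons_of_mem _ ht)
    rcases h z List.mem_cons_self with rfl | rfl
    · exact ⟨p + 1, q, by simpa [List.replicate_succ] using hpq⟩
    · refine ⟨p, q + 1, (hpq.cons z).trans ?_⟩
      rw [List.replicate_succ]
      exact List.perm_middle.symm

/-- The Wick formula for words in a pair of canonically commuting letters, given the
normally ordered moments. -/
lemma wick_formula_of_two_letters (K : I → I → ℂ) (φ : A →ₗ[ℂ] ℂ) (a : I → A) {x y : I}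
    (hx : K x x = 0) (hy : K y y = 0)
    (hcomm : a y * a x = a x * a y + algebraMap ℂ A (K y x - K x y))
    (hne : ∀ p q : ℕ, p ≠ q → φ (a x ^ p * a y ^ q) = 0)
    (heq : ∀ p : ℕ, φ (a x ^ p * a y ^ p) = (p.factorial : ℂ) * K x y ^ p)
    (l : List I) (hl : ∀ z ∈ l, z = x ∨ z = y) :
    φ (l.map a).prod = wick K l := by
  induction hn : l.length using Nat.strong_induction_on generalizing l with
  | _ n ih =>
  obtain ⟨p, q, hpq⟩ := exists_perm_replicate l hl
  refine wick_formula_of_perm K φ a l ?_ ?_ hpq ?_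
  · intro z hz z' hz'
    rcases hl z hz with rfl | rfl <;> rcases hl z' hz' with rfl | rfl
    · simp
    · rw [hcomm, add_assoc, ← map_add]; simp
    · exact hcomm
    · simp
  · intro r hr hmem
    exact ih r.length (hn ▸ hr) r (fun z hz => hl z (hmem z hz)) rfl
  · rw [wick_replicate_append K hx hy]
    simp only [List.map_append, List.map_replicate, List.prod_append, List.prod_replicate]
    split_ifs with h
    · subst h; exact heq p
    · exact hne p q h

lemma perm_flatMap_filter {L : Type*} [Fintype L] [DecidableEq L] (lab : I → L)
    (l : List I) :
    l.Perm ((Finset.univ : Finset L).toList.flatMap fun r => l.filter fun x => lab x = r) := by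
  classical
  rw [List.perm_iff_count]
  intro x
  rw [List.count_flatMap]
  have : ∀ r, List.count x (l.filter fun x => lab x = r) =
      if lab x = r then List.count x l else 0 := by
    intro r
    split_ifs with h
    · exact List.count_filter (by simpa using h)
    · exact List.count_eq_zero.2 (by simp [h])
  rw [Finset.sum_map_toList]
  simp [this]

end Reordering

lemma CommIndep.apply_prod_map {A : Type*} [Ring A] [Algebra ℂ A] [StarRing A] [StarModule ℂ A]
    {Λ : Type*} {φ : A →ₗ[ℂ] ℂ} {S : Λ → StarSubalgebra ℂ A} (h : CommIndep φ S)
    {t : List Λ} (ht : t.Nodup) (x : Λ → A) (hx : ∀ r, x r ∈ S r) :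
    φ (t.map x).prod = (t.map fun r => φ (x r)).prod := by
  have := h.2 t.length t.get (List.nodup_iff_injective_get.1 ht) (fun n => x (t.get n))
    fun n => hx _
  have hA : List.ofFn (fun n => x (t.get n)) = t.map x :=
    (List.map_ofFn (f := t.get) (g := x)).symm.trans (by rw [List.ofFn_get])
  have hC : List.ofFn (fun n => φ (x (t.get n))) = t.map fun r => φ (x r) :=
    (List.map_ofFn (f := t.get) (g := fun r => φ (x r))).symm.trans (by rw [List.ofFn_get])
  rw [← hA, this, ← hC, List.prod_ofFn]

/-- The Wick formula for a commuting independent family of blocks of letters, each of which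
satisfies the Wick formula. -/
lemma CommIndep.wick_formula {A : Type*} [Ring A] [Algebra ℂ A] [StarRing A] [StarModule ℂ A]
    {I Λ : Type*} [Fintype Λ] [DecidableEq Λ] {φ : A →ₗ[ℂ] ℂ} {S : Λ → StarSubalgebra ℂ A}
    (h : CommIndep φ S) (K : I → I → ℂ) (a : I → A) (lab : I → Λ)
    (ha : ∀ x, a x ∈ S (lab x)) (hK : ∀ x y, lab x ≠ lab y → K x y = 0)
    (hcomm : ∀ x y, lab x = lab y → a x * a y = a y * a x + algebraMap ℂ A (K x y - K y x))
    (hblock : ∀ r, ∀ l : List I, (∀ x ∈ l, lab x = r) → φ (l.map a).prod = wick K l)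
    (l : List I) : φ (l.map a).prod = wick K l := by
  induction hn : l.length using Nat.strong_induction_on generalizing l with
  | _ n ih =>
  refine wick_formula_of_perm K φ a l ?_ ?_ (perm_flatMap_filter lab l) ?_
  · intro x _ y _
    by_cases hxy : lab x = lab y
    · exact hcomm x y hxy
    · rw [hK x y hxy, hK y x (Ne.symm hxy), sub_self, map_zero, add_zero]
      exact h.1 _ _ hxy _ (ha x) _ (ha y)
  · intro r hr _
    exact ih r.length (hn ▸ hr) r rfl
  · rw [wick_flatMap K (Finset.nodup_toList _)]
    · have e : ∀ t : List Λ, ((t.flatMap fun r => l.filter fun x => lab x = r).map a).prod =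
          (t.map fun r => ((l.filter fun x => lab x = r).map a).prod).prod := by
        intro t
        induction t with
        | nil => simp
        | cons r t ih => rw [List.flatMap_cons, List.map_append, List.prod_append, ih]; simp
      rw [e, h.apply_prod_map (Finset.nodup_toList _)]
      · congr 1
        refine List.map_congr_left fun r _ => hblock r _ ?_
        intro x hx
        simpa using (List.mem_filter.1 hx).2
      · intro r
        refine list_prod_mem ?_
        intro z hz
        obtain ⟨x, hx, rfl⟩ := List.mem_map.1 hz
        have : lab x = r := by simpa using (List.mem_filter.1 hx).2
        exact this ▸ ha x
    · intro r s hrs x hx y hy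
      have h1 : lab x = r := by simpa using (List.mem_filter.1 hx).2
      have h2 : lab y = s := by simpa using (List.mem_filter.1 hy).2
      exact hK x y (by rw [h1, h2]; exact hrs)

section Labels

variable {d : ℕ}

/-- The independent block of the matrix position `x`: `none` for the diagonal, and otherwise
the position or its transpose, whichever is above the diagonal. -/
def blockLabel (x : Fin d × Fin d) : Option {p : Fin d × Fin d // p.1 < p.2} :=
  if h : x.1 < x.2 then some ⟨x, h⟩ else if h' : x.2 < x.1 then some ⟨x.swap, h'⟩ else none

lemma blockLabel_eq_none {x : Fin d × Fin d} : blockLabel x = none ↔ x.1 = x.2 := by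
  unfold blockLabel
  split_ifs with h h'
  · simp [h.ne]
  · simp [h'.ne']
  · simp [le_antisymm (not_lt.1 h') (not_lt.1 h)]

lemma blockLabel_eq_some {x : Fin d × Fin d} {p : {p : Fin d × Fin d // p.1 < p.2}} :
    blockLabel x = some p ↔ x = p.1 ∨ x = p.1.swap := by
  obtain ⟨⟨i, j⟩, hp⟩ := p
  obtain ⟨k, l⟩ := x
  unfold blockLabel
  simp only at hp
  split_ifs with h h' <;> simp at h ⊢
  · rintro rfl rfl; exact absurd h hp.not_gt
  · constructor
    · rintro ⟨rfl, rfl⟩; simp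
    · rintro (⟨rfl, rfl⟩ | ⟨rfl, rfl⟩)
      · exact absurd hp h.not_gt
      · simp
  · simp at h'
    constructor
    · rintro rfl rfl; exact absurd hp h.not_gt
    · rintro rfl rfl; exact absurd hp h'.not_gt

/-- The total weight of a pair of matrix positions, summed over the two colours. -/
def pairWeight (w : Fin d → ℝ) (x y : Fin d × Fin d) : ℝ :=
  (if x.1 = y.2 then (1 : ℝ) else 0) * (if y.1 = x.2 then (1 : ℝ) else 0) * w y.1 +
    (if x.1 = x.2 then (1 : ℝ) else 0) * (if y.1 = y.2 then (1 : ℝ) else 0) * (-(w x.1 * w y.1))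

lemma pairWeight_of_ne {w : Fin d → ℝ} {x y : Fin d × Fin d}
    (h : blockLabel x ≠ blockLabel y) : pairWeight w x y = 0 := by
  have h1 : ¬ (x.1 = y.2 ∧ y.1 = x.2) := by
    rintro ⟨h1, h2⟩
    apply h
    obtain rfl : x = y.swap := Prod.ext h1 h2.symm
    cases e : blockLabel y with
    | none =>
      rw [blockLabel_eq_none] at e ⊢
      exact e.symm
    | some p =>
      rw [blockLabel_eq_some] at e ⊢
      rcases e with rfl | rfl
      · exact Or.inr rfl
      · exact Or.inl (Prod.swap_swap _)
  have h2 : ¬ (x.1 = x.2 ∧ y.1 = y.2) := by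
    rintro ⟨h1, h2⟩
    exact h (by rw [blockLabel_eq_none.2 h1, blockLabel_eq_none.2 h2])
  unfold pairWeight
  split_ifs <;> simp_all

lemma pairWeight_diag (w : Fin d → ℝ) (i j : Fin d) :
    pairWeight w (i, i) (j, j) = if i = j then w i - w i ^ 2 else -(w i * w j) := by
  unfold pairWeight
  by_cases h : i = j
  · subst h; simp; ring
  · simp [h]

end Labels

/-- the Wick-style formula for the joint moments of the entries of a
traceless CCR-GUE matrix `M = [a i j]` with parameters `w_1, …, w_d`.  Bicoloured pair
partitions are encoded as pairs `(g, c)` of a fixed-point-free involution `g` of `Fin k`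
together with a colouring `c` constant on its pairs (`c = true` meaning blue). -/
theorem stmt18 {d : ℕ} (hd : 2 ≤ d) (w : Fin d → ℝ)
    (hmono : ∀ i j : Fin d, i ≤ j → w j ≤ w i)
    (hpos : ∀ i, 0 < w i) (hsum : ∑ i, w i = 1)
    {A : Type*} [Ring A] [Algebra ℂ A] [StarRing A] [StarModule ℂ A]
    (φ : A →ₗ[ℂ] ℂ) (hφ1 : φ 1 = 1)
    (a : Fin d → Fin d → A)
    (hsa : ∀ i j : Fin d, star (a i j) = a j i)
    (Ao : StarSubalgebra ℂ A)
    (Asub : Fin d → Fin d → StarSubalgebra ℂ A)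
    (hCI : CommIndep φ (fun l : Option {p : Fin d × Fin d // p.1 < p.2} =>
      l.elim Ao fun p => Asub p.1.1 p.1.2))
    (hmemd : ∀ i : Fin d, a i i ∈ Ao)
    (hAoComm : ∀ x ∈ Ao, ∀ y ∈ Ao, x * y = y * x)
    (hmem : ∀ i j : Fin d, i < j → a i j ∈ Asub i j)
    (hccr : ∀ i j : Fin d, i < j → IsCCRGaussian φ (a i j) (w j) (w i))
    (hgauss : IsGaussianFamily φ (fun i => a i i)
      (fun i j => if i = j then w i - w i ^ 2 else -(w i * w j)))
    (k : ℕ) (i j : Fin k → Fin d) :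
    φ ((List.ofFn fun h : Fin k => a (i h) (j h)).prod) =
      ∑ gc ∈ (Finset.univ : Finset (Equiv.Perm (Fin k) × (Fin k → Bool))).filter
          (fun gc => gc.1 * gc.1 = 1 ∧ (∀ x, gc.1 x ≠ x) ∧
            ∀ x, gc.2 (gc.1 x) = gc.2 x),
        (((∏ h ∈ Finset.univ.filter fun h : Fin k => h < gc.1 h ∧ gc.2 h = true,
            (if i h = j (gc.1 h) then (1 : ℝ) else 0) *
              (if i (gc.1 h) = j h then (1 : ℝ) else 0) * w (i (gc.1 h))) *
          ∏ h ∈ Finset.univ.filter fun h : Fin k => h < gc.1 h ∧ gc.2 h = false,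
            (if i h = j h then (1 : ℝ) else 0) *
              (if i (gc.1 h) = j (gc.1 h) then (1 : ℝ) else 0) *
              (-(w (i h) * w (i (gc.1 h)))) : ℝ) : ℂ) := by
  let K : Fin d × Fin d → Fin d × Fin d → ℂ := fun x y => (pairWeight w x y : ℂ)
  let b : Fin d × Fin d → A := fun x => a x.1 x.2
  have hdiag : ∀ l : List (Fin d × Fin d), (∀ x ∈ l, blockLabel x = none) →
      φ (l.map b).prod = wick K l := by
    intro l hl
    have e : l = List.ofFn fun n : Fin l.length => ((l.get n).1, (l.get n).1) := by
      conv_lhs => rw [← List.ofFn_get l]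
      congr 1
      funext n
      exact Prod.ext rfl (blockLabel_eq_none.1 (hl _ (l.get_mem n))).symm
    have hg := hgauss l.length fun n => (l.get n).1
    rw [e, List.map_ofFn, ← sum_pairInv]
    refine hg.trans (Finset.sum_congr rfl fun g _ => ?_)
    rw [Complex.ofReal_prod]
    refine Finset.prod_congr rfl fun h _ => ?_
    simp only [K, pairWeight_diag]
  have hoff : ∀ p : {p : Fin d × Fin d // p.1 < p.2},
      K p.1 p.1 = 0 ∧ K p.1.swap p.1.swap = 0 ∧ K p.1 p.1.swap = w p.1.2 ∧
        K p.1.swap p.1 = w p.1.1 := by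
    rintro ⟨⟨i, j⟩, hij⟩
    have hij' : i < j := hij
    simp [K, pairWeight, hij'.ne, hij'.ne']
  have hrel : ∀ p : {p : Fin d × Fin d // p.1 < p.2},
      b p.1.swap * b p.1 = b p.1 * b p.1.swap +
        algebraMap ℂ A (K p.1.swap p.1 - K p.1 p.1.swap) := by
    intro p
    obtain ⟨-, -, h, -, -⟩ := hccr p.1.1 p.1.2 p.2
    rw [hsa] at h
    rw [(hoff p).2.2.1, (hoff p).2.2.2]
    exact h
  have main : ∀ l : List (Fin d × Fin d), φ (l.map b).prod = wick K l := by
    refine hCI.wick_formula K b blockLabel ?_ ?_ ?_ ?_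
    · intro x
      cases e : blockLabel x with
      | none =>
        rw [blockLabel_eq_none] at e
        have := hmemd x.1
        simp only [b, ← e]
        exact this
      | some p =>
        rw [blockLabel_eq_some] at e
        have hp := hmem _ _ p.2
        rcases e with rfl | rfl
        · exact hp
        · have := star_mem hp
          rw [hsa] at this
          exact this
    · intro x y hxy
      simp only [K, pairWeight_of_ne hxy, Complex.ofReal_zero]
    · intro x y hxy
      cases e : blockLabel x with
      | none =>
        have e' := hxy.symm.trans e
        rw [blockLabel_eq_none] at e e'
        obtain ⟨i, i'⟩ := x
        obtain ⟨j, j'⟩ := y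
        obtain rfl : i = i' := e
        obtain rfl : j = j' := e'
        have hs : K (i, i) (j, j) = K (j, j) (i, i) := by
          simp only [K, pairWeight_diag]
          by_cases h : i = j
          · rw [h]
          · rw [if_neg h, if_neg (Ne.symm h), mul_comm]
        rw [hs, sub_self, map_zero, add_zero]
        exact hAoComm _ (hmemd i) _ (hmemd j)
      | some p =>
        have e' := hxy.symm.trans e
        rw [blockLabel_eq_some] at e e'
        rcases e with rfl | rfl <;> rcases e' with rfl | rfl
        · simp
        · rw [hrel, add_assoc, ← map_add]; simp
        · exact hrel p
        · simp
    · intro r l hl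
      cases r with
      | none => exact hdiag l hl
      | some p =>
        obtain ⟨-, -, -, h1, h2⟩ := hccr p.1.1 p.1.2 p.2
        rw [hsa] at h1 h2
        refine wick_formula_of_two_letters K φ b (hoff p).1 (hoff p).2.1 (hrel p) h1 ?_ l
          fun z hz => blockLabel_eq_some.1 (hl z hz)
        intro n
        rw [(hoff p).2.2.1]
        exact h2 n
  have hmain := main (List.ofFn fun h => (i h, j h))
  rw [List.map_ofFn, ← sum_pairInv] at hmain
  refine hmain.trans ?_
  rw [Finset.sum_filter, ← Finset.univ_product_univ, Finset.sum_product, pairInv,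
    Finset.sum_filter]
  refine Finset.sum_congr rfl fun g _ => ?_
  split_ifs with hg
  · have hg1 : ∀ x, g (g x) = x := fun x => by
      rw [← Equiv.Perm.mul_apply, hg.1, Equiv.Perm.one_apply]
    have hc := sum_colourings hg1 hg.2
      (fun h => (if i h = j (g h) then (1 : ℝ) else 0) *
        (if i (g h) = j h then (1 : ℝ) else 0) * w (i (g h)))
      (fun h => (if i h = j h then (1 : ℝ) else 0) *
        (if i (g h) = j (g h) then (1 : ℝ) else 0) * (-(w (i h) * w (i (g h)))))
    simp only [K, ← Complex.ofReal_prod]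
    refine (congrArg Complex.ofReal hc).symm.trans ?_
    rw [Finset.sum_filter, Complex.ofReal_sum]
    refine Finset.sum_congr rfl fun c _ => ?_
    by_cases hcc : ∀ x, c (g x) = c x
    · rw [if_pos hcc, if_pos ⟨hg.1, hg.2, hcc⟩]
    · rw [if_neg hcc, if_neg fun H => hcc H.2.2, Complex.ofReal_zero]
  · refine (Finset.sum_eq_zero fun c _ => if_neg ?_).symm
    exact fun H => hg ⟨H.1, H.2.1⟩
end
end
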